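/- Let D_1, …, D_h be division rings of characteristic zero, fix positive integers n_1, …, n_h, let F be a field of characteristic zero, and let g : M_{n_1}(D_1) × ⋯ × M_{n_h}(D_h) → M_m(F) be a map satisfying g(MN) = g(M)g(N) for all M, N and g(1) = 1 (a homomorphism of multiplicative monoids). If M is quasi-unipotent then g(M) is quasi-unipotent, and if M is unipotent then g(M) is unipotent. -/

import Mathlib

/-- A nilpotent endomorphism `N` of a finite-dimensional vector space over a division ring is
similar to `N * u` for every injective `u` commuting with `N`. -/
theorem Module.End.exists_injective_mul_eq_mul_mul {K V : Type*} [DivisionRing K]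
    [AddCommGroup V] [Module K V] [FiniteDimensional K V] (k : ℕ) (N u : Module.End K V)
    (hNu : Commute N u) (hu : Function.Injective u) (hN : N ^ k = 0) :
    ∃ P : Module.End K V, Function.Injective P ∧ P * N = N * u * P := by
  induction k generalizing V with
  | zero =>
    have h0 : ∀ x : V, x = 0 := fun x => by simpa using LinearMap.congr_fun hN x
    exact ⟨1, fun x y _ => (h0 x).trans (h0 y).symm, LinearMap.ext fun x => by simp [h0 x]⟩
  | succ k ih =>
    have huN : ∀ x, N (u x) = u (N x) := fun x => LinearMap.congr_fun hNu.eq x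
    have hu_surj : Function.Surjective u := LinearMap.injective_iff_surjective.mp hu
    let W := LinearMap.range N
    have hNW : ∀ x ∈ W, N x ∈ W := fun x _ => ⟨x, rfl⟩
    have huW : ∀ x ∈ W, u x ∈ W := by
      rintro _ ⟨y, rfl⟩
      exact ⟨u y, huN y⟩
    obtain ⟨Q, hQ, hQN⟩ := ih (N.restrict hNW) (u.restrict huW)
      (LinearMap.ext fun x => Subtype.ext (huN x))
      (fun x y hxy => Subtype.ext (hu (congrArg Subtype.val hxy)))
      (by
        ext ⟨_, y, rfl⟩
        rw [Module.End.pow_restrict]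
        simpa [pow_succ] using LinearMap.congr_fun hN y)
    have hQN' : ∀ w : W, (Q (N.rangeRestrict w) : V) = N (u (Q w)) := fun w =>
      congrArg Subtype.val (LinearMap.congr_fun hQN w)
    -- `s` is a section of `N * u : V → W`
    obtain ⟨s, hs⟩ := (N.rangeRestrict ∘ₗ u).exists_rightInverse_of_surjective
      (LinearMap.range_eq_top.mpr ((LinearMap.surjective_rangeRestrict N).comp hu_surj))
    have hs' : ∀ w : W, N (u (s w)) = w := fun w =>
      congrArg Subtype.val (LinearMap.congr_fun hs w)
    -- `L` is a complement of `W ⊓ ker N` in `ker N`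
    obtain ⟨C, hC⟩ := exists_isCompl (W ⊓ LinearMap.ker N)
    let L := C ⊓ LinearMap.ker N
    have hWL : Disjoint W L := by
      rw [disjoint_iff, ← hC.disjoint.eq_bot]
      simp only [L]
      ac_rfl
    have hker : ∀ x, N x = 0 → ∃ w : W, ∃ l : L, x = w + l := by
      intro x hx
      obtain ⟨w, hw, c, hc, rfl⟩ := Submodule.mem_sup.mp
        (show x ∈ W ⊓ LinearMap.ker N ⊔ C by rw [hC.sup_eq_top]; trivial)
      have hw0 : N w = 0 := hw.2
      exact ⟨⟨w, hw.1⟩, ⟨c, hc, by simpa [hw0] using hx⟩, rfl⟩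
    obtain ⟨r, hr⟩ := (W.subtype.coprod L.subtype).exists_leftInverse_of_injective (by
      rw [LinearMap.ker_coprod_of_disjoint_range] <;> simp [hWL])
    have hr' : ∀ (w : W) (l : L), r (w + l) = (w, l) := fun w l =>
      LinearMap.congr_fun hr (w, l)
    let δ : W × L →ₗ[K] V :=
      (W.subtype ∘ₗ Q - s ∘ₗ Q ∘ₗ N.rangeRestrict ∘ₗ W.subtype).coprod L.subtype
    let P : Module.End K V := s ∘ₗ Q ∘ₗ N.rangeRestrict + δ ∘ₗ r
    have hδ_apply : ∀ (w : W) (l : L), δ (w, l) = Q w - s (Q (N.rangeRestrict w)) + l :=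
      fun _ _ => rfl
    have hδ : ∀ z, N (u (δ z)) = 0 := by
      rintro ⟨w, l⟩
      have hl : N (l : V) = 0 := l.2.2
      rw [hδ_apply, map_add, map_sub, map_add, map_sub, hs', hQN', huN l, hl]
      simp
    have hP : ∀ x, P x = s (Q (N.rangeRestrict x)) + δ (r x) := fun x => rfl
    have hPN : ∀ x, N (u (P x)) = Q (N.rangeRestrict x) := fun x => by
      rw [hP, map_add, map_add, hδ, hs', add_zero]
    have hPadd : ∀ (w : W) (l : L), P (w + l) = Q w + l := by
      intro w l
      have hl : N.rangeRestrict (l : V) = 0 := Subtype.ext l.2.2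
      rw [hP, hr', hδ_apply, map_add, hl, add_zero]
      abel
    refine ⟨P, ?_, ?_⟩
    · rw [injective_iff_map_eq_zero]
      intro x hx
      have hNx : N.rangeRestrict x = 0 := by
        apply hQ
        apply Subtype.ext
        rw [← hPN, hx]
        simp
      obtain ⟨w, l, rfl⟩ := hker x (congrArg Subtype.val hNx)
      rw [hPadd] at hx
      have hQw : (Q w : V) = 0 := by
        refine Submodule.disjoint_def.mp hWL _ (Q w).2 ?_
        rw [eq_neg_of_add_eq_zero_left hx]
        exact L.neg_mem l.2
      have hw : w = 0 := hQ (by rw [map_zero]; exact Subtype.ext hQw)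
      rw [hQw, zero_add] at hx
      rw [hw, hx]
      simp
    · ext x
      have := hPadd (N.rangeRestrict x) 0
      simp only [ZeroMemClass.coe_zero, add_zero] at this
      exact this.trans (hPN x).symm

theorem isUnit_geom_sum_of_isNilpotent_sub_one {R : Type*} [Ring R] {a : R}
    (ha : IsNilpotent (a - 1)) {k : ℕ} (hk : IsUnit (k : R)) :
    IsUnit (∑ i ∈ Finset.range k, a ^ i) := by
  have hcomm : ∀ i j : ℕ, Commute (a ^ i - 1) (a ^ j - 1) := fun i j =>
    ((Commute.pow_pow_self a i j).sub_left (Commute.one_left _)).sub_right (Commute.one_right _)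
  have hnil : IsNilpotent (∑ i ∈ Finset.range k, (a ^ i - 1)) := by
    refine Commute.isNilpotent_sum (fun i _ => ?_) fun i j _ _ => hcomm i j
    rw [← mul_geom_sum]
    refine Commute.isNilpotent_mul_right ?_ ha
    exact Commute.sum_right _ _ _ fun j _ =>
      ((Commute.refl a).pow_right j).sub_left (Commute.one_left _)
  have h := hnil.isUnit_add_right_of_commute hk (Nat.cast_commute k _).symm
  simpa using h

/-- Over a division ring of characteristic zero, a unipotent matrix is similar to its positive
powers. -/
theorem Matrix.exists_isUnit_mul_eq_pow_mul_of_unipotent {D ι : Type*} [DivisionRing D]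
    [CharZero D] [Fintype ι] [DecidableEq ι] {A : Matrix ι ι D} (hA : IsNilpotent (A - 1))
    {k : ℕ} (hk : k ≠ 0) : ∃ P : (Matrix ι ι D)ˣ, A * P = P * A ^ k := by
  obtain ⟨d, hd⟩ := hA
  have hk' : IsUnit (k : Matrix ι ι D) := by
    have := (IsUnit.mk0 (k : D) (Nat.cast_ne_zero.mpr hk)).map (Matrix.scalar ι)
    simpa using this
  set U := ∑ i ∈ Finset.range k, A ^ i
  have hUu : IsUnit U := isUnit_geom_sum_of_isNilpotent_sub_one ⟨d, hd⟩ hk'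
  have hNU : (A - 1) * U = A ^ k - 1 := mul_geom_sum A k
  have hUN : U * (A - 1) = A ^ k - 1 := geom_sum_mul A k
  let φ : Matrix ι ι D → Module.End D (ι → D) := Matrix.toLinearMapRight'
  have hφmul : ∀ X Y, φ (X * Y) = φ Y * φ X := fun X Y => Matrix.toLinearMapRight'_mul X Y
  have hφone : φ 1 = 1 := Matrix.toLinearMapRight'_one
  have hφpow : ∀ X (j : ℕ), φ (X ^ j) = φ X ^ j := by
    intro X j
    induction j with
    | zero => simpa using hφone
    | succ j ih => rw [pow_succ, pow_succ', hφmul, ih]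
  obtain ⟨V, hV⟩ := hUu.exists_right_inv
  have hUinj : Function.Injective (φ U) := by
    have h : φ V * φ U = 1 := by rw [← hφmul, hV, hφone]
    exact Function.LeftInverse.injective (g := φ V) fun x => LinearMap.congr_fun h x
  obtain ⟨P, hP, hPN⟩ := Module.End.exists_injective_mul_eq_mul_mul d (φ (A - 1)) (φ U)
    (by rw [Commute, SemiconjBy, ← hφmul, ← hφmul, hNU, hUN]) hUinj
    (by rw [← hφpow, hd]; exact map_zero Matrix.toLinearMapRight')
  obtain ⟨p, rfl⟩ : ∃ p, φ p = P := Matrix.toLinearMapRight'.surjective P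
  obtain ⟨Q, hQ⟩ := LinearMap.exists_leftInverse_of_injective _ (LinearMap.ker_eq_bot.mpr hP)
  obtain ⟨q, rfl⟩ : ∃ q, φ q = Q := Matrix.toLinearMapRight'.surjective Q
  have hφinj : Function.Injective φ := Matrix.toLinearMapRight'.injective
  have hpq : p * q = 1 := hφinj (by rw [hφmul, hφone]; exact hQ)
  have hqp : q * p = 1 := hφinj (by
    rw [hφmul, hφone]; exact mul_eq_one_comm.mp hQ)
  refine ⟨⟨p, q, hpq, hqp⟩, ?_⟩
  have h : (A - 1) * p = p * (A ^ k - 1) := by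
    apply hφinj
    rw [hφmul, hPN, ← hφmul, hUN, ← hφmul]
  simpa [sub_mul, mul_sub] using h

/-- A square matrix over an algebraically closed field whose spectrum is contained in `{1}` is
unipotent. -/
theorem Matrix.isNilpotent_sub_one_of_spectrum {K ι : Type*} [Field K] [IsAlgClosed K]
    [Fintype ι] [DecidableEq ι] {A : Matrix ι ι K} (hA : ∀ r ∈ spectrum K A, r = 1) :
    IsNilpotent (A - 1) := by
  have hroots : A.charpoly.roots = Multiset.replicate (Multiset.card A.charpoly.roots) 1 :=
    Multiset.eq_replicate_card.mpr fun r hr =>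
      hA r (Matrix.mem_spectrum_of_isRoot_charpoly (Polynomial.isRoot_of_mem_roots hr))
  have hprod := (IsAlgClosed.splits A.charpoly).eq_prod_roots_of_monic A.charpoly_monic
  rw [hroots, Multiset.map_replicate, Multiset.prod_replicate] at hprod
  refine ⟨Multiset.card A.charpoly.roots, ?_⟩
  have := Matrix.aeval_self_charpoly A
  rw [hprod] at this
  simpa only [map_pow, map_sub, Polynomial.aeval_X, map_one] using this

/-- An invertible matrix over a field that is similar to all its positive powers is unipotent. -/
theorem Matrix.isNilpotent_sub_one_of_similar_pow {F ι : Type*} [Field F] [Fintype ι]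
    [DecidableEq ι] {A : Matrix ι ι F} (hA : IsUnit A)
    (h : ∀ k : ℕ, k ≠ 0 → ∃ P : (Matrix ι ι F)ˣ, A * P = P * A ^ k) :
    IsNilpotent (A - 1) := by
  let K := AlgebraicClosure F
  let f : Matrix ι ι F →+* Matrix ι ι K := (algebraMap F K).mapMatrix
  have hf : Function.Injective f := Matrix.map_injective (algebraMap F K).injective
  have hspec : ∀ k : ℕ, k ≠ 0 → spectrum K (f A) = (· ^ k) '' spectrum K (f A) := by
    intro k hk
    obtain ⟨P, hP⟩ := h k hk
    rw [← spectrum.map_pow_of_pos _ (Nat.pos_of_ne_zero hk)]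
    have hP' : f A = Units.map f.toMonoidHom P * f A ^ k * (Units.map f.toMonoidHom P)⁻¹ := by
      rw [Units.eq_mul_inv_iff_mul_eq]
      simpa using congrArg f hP
    conv_lhs => rw [hP', spectrum.units_conjugate]
  have hfin : (spectrum K (f A)).Finite := Matrix.finite_spectrum _
  have hne : ∀ r ∈ spectrum K (f A), r ≠ 0 := by
    rintro r hr rfl
    exact spectrum.zero_mem_iff K |>.mp hr (hA.map f)
  have hord : ∀ r ∈ spectrum K (f A), 0 < orderOf r := by
    intro r hr
    obtain ⟨i, -, j, -, hij, heq⟩ := Set.infinite_univ.exists_ne_map_eq_of_mapsTo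
      (f := fun i : ℕ => r ^ (i + 1)) (t := spectrum K (f A))
      (fun i _ => by rw [hspec (i + 1) i.succ_ne_zero]; exact ⟨r, hr, rfl⟩) hfin
    rw [← Units.val_mk0 (hne r hr), orderOf_units]
    refine Nat.pos_of_ne_zero fun h0 => hij (Nat.succ_injective ?_)
    exact (pow_inj_iff_of_orderOf_eq_zero h0).mp (Units.ext (by simpa using heq))
  have hN : ∏ r ∈ hfin.toFinset, orderOf r ≠ 0 :=
    Finset.prod_ne_zero_iff.mpr fun r hr => (hord r (hfin.mem_toFinset.mp hr)).ne'
  have hone : IsNilpotent (f A - 1) := by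
    apply Matrix.isNilpotent_sub_one_of_spectrum
    intro r hr
    rw [hspec _ hN] at hr
    obtain ⟨t, ht, rfl⟩ := hr
    exact orderOf_dvd_iff_pow_eq_one.mp
      (Finset.dvd_prod_of_mem orderOf (hfin.mem_toFinset.mpr ht))
  rw [← IsNilpotent.map_iff hf]
  simpa using hone

theorem monoid_hom_preserves_unipotency
    {h : ℕ} (D : Fin h → Type*) [∀ i, DivisionRing (D i)] [∀ i, CharZero (D i)]
    (n : Fin h → ℕ) (hn : ∀ i, 0 < n i)
    {F : Type*} [Field F] [CharZero F] (m : ℕ)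
    (g : (∀ i, Matrix (Fin (n i)) (Fin (n i)) (D i)) →* Matrix (Fin m) (Fin m) F)
    (M : ∀ i, Matrix (Fin (n i)) (Fin (n i)) (D i)) :
    ((∃ s : ℕ, 1 ≤ s ∧ IsNilpotent (M ^ s - 1)) →
        ∃ s : ℕ, 1 ≤ s ∧ IsNilpotent (g M ^ s - 1)) ∧
    (IsNilpotent (M - 1) → IsNilpotent (g M - 1)) := by
  have key : ∀ X : (∀ i, Matrix (Fin (n i)) (Fin (n i)) (D i)),
      IsNilpotent (X - 1) → IsNilpotent (g X - 1) := by
    intro X hX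
    have hXi : ∀ i, IsNilpotent (X i - 1) := fun i =>
      hX.map (Pi.evalRingHom (fun i => Matrix (Fin (n i)) (Fin (n i)) (D i)) i)
    have hunit : IsUnit X := by simpa using hX.isUnit_add_one
    refine Matrix.isNilpotent_sub_one_of_similar_pow (hunit.map g) fun k hk => ?_
    choose P hP using fun i => Matrix.exists_isUnit_mul_eq_pow_mul_of_unipotent (hXi i) hk
    refine ⟨Units.map g (MulEquiv.piUnits.symm P), ?_⟩
    rw [Units.coe_map, ← map_pow, ← map_mul, ← map_mul]
    exact congrArg g (funext hP)
  refine ⟨?_, key M⟩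
  rintro ⟨s, hs, hM⟩
  exact ⟨s, hs, by simpa using key (M ^ s) hM⟩
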